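/- Let n ≥ 2 and let Q be an n×n real matrix with zero row sums (Q·𝟙ₙ = 0) whose last row is identically zero. Let R be the n×n diagonal matrix with diagonal entries (1, 1, …, 1, −1). Let u₁ ∈ ℝⁿ be the column vector whose first n−1 entries are 1 and whose last entry is −1, let u₂ be the first standard basis vector, u = u₁ − √n·u₂, and P = I − (2/(uᵀu))·u·uᵀ. Then every entry of the first column of Pᵀ·Q·R⁻¹·P is zero; equivalently, Pᵀ·Q·R⁻¹·P has the block form [[F, ∗],[0, A]] where the 1×1 top-left block F equals 0. -/

import Mathlib

open Matrix

/-- The Householder matrix of `v - w` sends `w` to `v` when `v` and `w` have equal length. -/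
theorem householder_sub_mulVec {ι : Type*} [Fintype ι] [DecidableEq ι] {v w : ι → ℝ}
    (hvw : v ⬝ᵥ v = w ⬝ᵥ w) :
    (1 - (2 / ((v - w) ⬝ᵥ (v - w))) • vecMulVec (v - w) (v - w)) *ᵥ w = v := by
  obtain rfl | hne := eq_or_ne v w
  · simp
  have hpos : (v - w) ⬝ᵥ (v - w) ≠ 0 := by
    rwa [Ne, dotProduct_self_eq_zero, sub_eq_zero]
  have hself : (v - w) ⬝ᵥ (v - w) = -2 * ((v - w) ⬝ᵥ w) := by
    simp only [sub_dotProduct, dotProduct_sub, hvw, dotProduct_comm w v]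
    ring
  have hcoef : 2 / ((v - w) ⬝ᵥ (v - w)) * ((v - w) ⬝ᵥ w) = -1 := by
    field_simp
    linarith
  rw [sub_mulVec, one_mulVec, smul_mulVec, vecMulVec_mulVec, op_smul_eq_smul, smul_smul, hcoef]
  simp

/-- **Lemma 2 of the paper.** Let `n ≥ 2`, let `Q` be an `n × n` real matrix with
zero row sums whose last row is identically zero, and let `R = diag(1,…,1,−1)`. With the
Householder matrix `P` built from `u₁` (first `n−1` entries `1`, last entry `−1`),
`u₂` (first standard basis vector) and `u = u₁ − √n·u₂`, every entry of the first column of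
`Pᵀ·Q·R⁻¹·P` is zero, i.e. `Pᵀ·Q·R⁻¹·P` has block form `[[F, ∗],[0, A]]` with the `1 × 1`
top-left block `F = 0`. -/
theorem householder_schur_factorization
    (n : ℕ) (hn : 2 ≤ n)
    (Q : Matrix (Fin n) (Fin n) ℝ)
    (hQrow : Q.mulVec (fun _ => 1) = 0)
    (hQlast : ∀ (i j : Fin n), (i : ℕ) = n - 1 → Q i j = 0)
    (R : Matrix (Fin n) (Fin n) ℝ)
    (hR : R = Matrix.diagonal (fun i : Fin n => if (i : ℕ) = n - 1 then -1 else 1))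
    (u₁ u₂ u : Fin n → ℝ)
    (hu₁ : ∀ i, u₁ i = if (i : ℕ) = n - 1 then -1 else 1)
    (hu₂ : ∀ i, u₂ i = if (i : ℕ) = 0 then 1 else 0)
    (hu : u = u₁ - Real.sqrt n • u₂)
    (P : Matrix (Fin n) (Fin n) ℝ)
    (hP : P = 1 - (2 / (u ⬝ᵥ u)) • Matrix.vecMulVec u u) :
    ∀ i j : Fin n, (j : ℕ) = 0 → (Pᵀ * Q * R⁻¹ * P) i j = 0 := by
  intro i j hj
  have hu₂_single : u₂ = Pi.single j 1 := by
    ext k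
    simp [hu₂, Pi.single_apply, Fin.ext_iff, hj]
  have hsqrt : Real.sqrt n ≠ 0 := by
    have : (0 : ℝ) < n := by exact_mod_cast (by omega : 0 < n)
    exact (Real.sqrt_pos.mpr this).ne'
  have hlen : u₁ ⬝ᵥ u₁ = (Real.sqrt n • u₂) ⬝ᵥ (Real.sqrt n • u₂) := by
    have hsq : ∀ k, u₁ k * u₁ k = 1 := fun k => by
      rw [hu₁]
      split_ifs <;> norm_num
    simp [hu₂_single, dotProduct, hsq, Pi.single_apply]
  have hPu₂ : Real.sqrt n • P *ᵥ u₂ = u₁ := by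
    rw [← mulVec_smul, hP, hu]
    exact householder_sub_mulVec hlen
  have hRR : R * R = 1 := by
    rw [hR, diagonal_mul_diagonal, ← diagonal_one]
    congr 1
    ext k
    split_ifs <;> norm_num
  have hRu₁ : R⁻¹ *ᵥ u₁ = fun _ => 1 := by
    rw [inv_eq_right_inv hRR]
    ext k
    rw [hR, mulVec_diagonal, hu₁]
    split_ifs <;> norm_num
  have hcol : Real.sqrt n • (Pᵀ * Q * R⁻¹ * P) *ᵥ u₂ = 0 := by
    simp only [← mulVec_mulVec, ← mulVec_smul Pᵀ, ← mulVec_smul Q, ← mulVec_smul R⁻¹,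
      hPu₂, hRu₁, hQrow, mulVec_zero]
  have hzero := congrFun ((smul_eq_zero.mp hcol).resolve_left hsqrt) i
  simpa [hu₂_single] using hzero
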